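/- For every set S of N points in the plane in general position, ĥv_x(S) ≥ N/4096. -/

import Mathlib

open scoped Classical

noncomputable section

/-- A point in the plane. -/
abbrev Pt : Type := ℝ × ℝ

/-- `S` is in general position: no three distinct points of `S` are collinear. -/
def GenPos (S : Finset Pt) : Prop :=
  ∀ p ∈ S, ∀ q ∈ S, ∀ r ∈ S, p ≠ q → p ≠ r → q ≠ r →
    ¬ Collinear ℝ ({p, q, r} : Set Pt)

/-- Two straight edges cross if their relative interiors (open segments) meet. -/
def EdgesCross (e f : Sym2 Pt) : Prop :=
  ∃ a b c d : Pt, e = s(a, b) ∧ f = s(c, d) ∧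
    (openSegment ℝ a b ∩ openSegment ℝ c d).Nonempty

/-- `G` is a crossing-free straight-edge (plane) graph on the point set `S`:
its edges are nondegenerate straight segments between points of `S`,
and no two distinct edges cross. -/
def IsPlaneGraph (S : Finset Pt) (G : Finset (Sym2 Pt)) : Prop :=
  (∀ e ∈ G, ¬ e.IsDiag ∧ ∀ p ∈ e, p ∈ S) ∧
    ∀ e ∈ G, ∀ f ∈ G, e ≠ f → ¬ EdgesCross e f

/-- The (finite) collection of all plane graphs on `S`. -/
def planeGraphs (S : Finset Pt) : Finset (Finset (Sym2 Pt)) :=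
  S.sym2.powerset.filter (IsPlaneGraph S)

/-- The degree of the point `p` in the graph `G`. -/
def vingDeg (G : Finset (Sym2 Pt)) (p : Pt) : ℕ :=
  (G.filter fun e => p ∈ e).card

/-- The ving `(p, G)` is an x-ving: no straight edge from `p` to another point
of `S` can be added to `G` while keeping the graph plane. -/
def IsXVing (S : Finset Pt) (G : Finset (Sym2 Pt)) (p : Pt) : Prop :=
  ∀ q ∈ S, q ≠ p → s(p, q) ∉ G → ¬ IsPlaneGraph S (insert s(p, q) G)

/-- `v_x(G)`: the number of x-vings of `G`. -/
def vx (S : Finset Pt) (G : Finset (Sym2 Pt)) : ℕ :=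
  (S.filter (IsXVing S G)).card

/-- `v_i(G)`: the number of vertices of degree exactly `i` in `G`. -/
def vdeg (S : Finset Pt) (G : Finset (Sym2 Pt)) (i : ℕ) : ℕ :=
  (S.filter fun p => vingDeg G p = i).card

/-- `ĥv_x(S)`: the average of `v_x(G)` over a uniformly random plane graph on `S`. -/
def hvx (S : Finset Pt) : ℝ :=
  (∑ G ∈ planeGraphs S, (vx S G : ℝ)) / (planeGraphs S).card

/-- `ĥv_i(S)`: the average of `v_i(G)` over a uniformly random plane graph on `S`. -/
def hvdeg (S : Finset Pt) (i : ℕ) : ℝ :=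
  (∑ G ∈ planeGraphs S, (vdeg S G i : ℝ)) / (planeGraphs S).card

/-- `pg(N)`: the maximum number of plane graphs over all sets of `N` points in
general position. -/
def pgMax (N : ℕ) : ℕ :=
  sSup {n : ℕ | ∃ S : Finset Pt, S.card = N ∧ GenPos S ∧ (planeGraphs S).card = n}

/-- The plane graphs on `S` with at most `m` edges. -/
def planeGraphsLE (S : Finset Pt) (m : ℝ) : Finset (Finset (Sym2 Pt)) :=
  (planeGraphs S).filter fun G => (G.card : ℝ) ≤ m

/-- `ĥv_{x,m}(S)`: the average of `v_x(G)` over a uniformly random plane graph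
on `S` with at most `m` edges. -/
def hvxLE (S : Finset Pt) (m : ℝ) : ℝ :=
  (∑ G ∈ planeGraphsLE S m, (vx S G : ℝ)) / (planeGraphsLE S m).card

/-- `G` has no vertex (point of `S`) of degree smaller than `i`. -/
def MinDegGe (S : Finset Pt) (G : Finset (Sym2 Pt)) (i : ℕ) : Prop :=
  ∀ p ∈ S, i ≤ vingDeg G p

/-- The plane graphs on `S` with no vertex of degree smaller than `i`. -/
def planeGraphsDeg (S : Finset Pt) (i : ℕ) : Finset (Finset (Sym2 Pt)) :=
  (planeGraphs S).filter fun G => MinDegGe S G i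

/-- The plane graphs on `S` with at most `m` edges and no vertex of degree
smaller than `i`. -/
def planeGraphsLEDeg (S : Finset Pt) (m : ℝ) (i : ℕ) : Finset (Finset (Sym2 Pt)) :=
  (planeGraphs S).filter fun G => (G.card : ℝ) ≤ m ∧ MinDegGe S G i

/-- `ĥv_{x,m}(S,i)`: the average of `v_x(G)` over a uniformly random plane graph
on `S` with at most `m` edges and no vertex of degree smaller than `i`. -/
def hvxLEDeg (S : Finset Pt) (m : ℝ) (i : ℕ) : ℝ :=
  (∑ G ∈ planeGraphsLEDeg S m i, (vx S G : ℝ)) / (planeGraphsLEDeg S m i).card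

/-- `pg(N, i)`: the maximum, over sets `S` of `N` points in general position, of
the number of plane graphs on `S` with no vertex of degree smaller than `i`. -/
def pgMaxDeg (N i : ℕ) : ℕ :=
  sSup {n : ℕ | ∃ S : Finset Pt, S.card = N ∧ GenPos S ∧ (planeGraphsDeg S i).card = n}

/-- The underlying abstract graph of `G` on the vertex set `S`. -/
def abstractGraph (S : Finset Pt) (G : Finset (Sym2 Pt)) :
    SimpleGraph (S : Set Pt) :=
  SimpleGraph.induce (S : Set Pt) (SimpleGraph.fromEdgeSet (G : Set (Sym2 Pt)))

/-- The connected plane graphs on `S`. -/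
def connPlaneGraphs (S : Finset Pt) : Finset (Finset (Sym2 Pt)) :=
  (planeGraphs S).filter fun G => (abstractGraph S G).Connected

/-- The underlying abstract graph of `G` is bi-connected (2-vertex-connected):
it is connected and remains connected after deletion of any single vertex. -/
def Biconnected (S : Finset Pt) (G : Finset (Sym2 Pt)) : Prop :=
  (abstractGraph S G).Connected ∧
    ∀ v ∈ S, (SimpleGraph.induce ((S : Set Pt) \ {v})
      (SimpleGraph.fromEdgeSet (G : Set (Sym2 Pt)))).Connected

/-- The bi-connected plane graphs on `S`. -/
def biconnPlaneGraphs (S : Finset Pt) : Finset (Finset (Sym2 Pt)) :=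
  (planeGraphs S).filter (Biconnected S)

/-- `G` is a `k`-quasi-plane graph on `S`: a straight-edge graph on `S`
(crossings allowed) with no `k` pairwise crossing edges. -/
def IsQuasiPlane (k : ℕ) (S : Finset Pt) (G : Finset (Sym2 Pt)) : Prop :=
  (∀ e ∈ G, ¬ e.IsDiag ∧ ∀ p ∈ e, p ∈ S) ∧
    ¬ ∃ T ⊆ G, T.card = k ∧ ∀ e ∈ T, ∀ f ∈ T, e ≠ f → EdgesCross e f

/-- The (finite) collection of all `k`-quasi-plane graphs on `S`. -/
def qpGraphs (k : ℕ) (S : Finset Pt) : Finset (Finset (Sym2 Pt)) :=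
  S.sym2.powerset.filter (IsQuasiPlane k S)

/-- The ving `(p, G)` is an x-ving of the `k`-quasi-plane graph `G`: no straight
edge from `p` to another point of `S` can be added to `G` without violating
`k`-quasi-planarity. -/
def IsXVingQP (k : ℕ) (S : Finset Pt) (G : Finset (Sym2 Pt)) (p : Pt) : Prop :=
  ∀ q ∈ S, q ≠ p → s(p, q) ∉ G → ¬ IsQuasiPlane k S (insert s(p, q) G)

/-- `v_x(G)` for a `k`-quasi-plane graph `G`. -/
def vxQP (k : ℕ) (S : Finset Pt) (G : Finset (Sym2 Pt)) : ℕ :=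
  (S.filter (IsXVingQP k S G)).card

/-- `ĥv_x^k(S)`: the average of `v_x(G)` over a uniformly random `k`-quasi-plane
graph on `S`. -/
def hvxQP (k : ℕ) (S : Finset Pt) : ℝ :=
  (∑ G ∈ qpGraphs k S, (vxQP k S G : ℝ)) / (qpGraphs k S).card

/-- `qp_k(N)`: the maximum number of `k`-quasi-plane graphs over all sets of `N`
points in general position. -/
def qpMax (k N : ℕ) : ℕ :=
  sSup {n : ℕ | ∃ S : Finset Pt, S.card = N ∧ GenPos S ∧ (qpGraphs k S).card = n}

/-- Twice the signed area of the triangle `abc`. -/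
def cr (a b c : Pt) : ℝ := (b.1 - a.1) * (c.2 - a.2) - (b.2 - a.2) * (c.1 - a.1)

lemma mem_openSegment_iff_coords {a b z : Pt} :
    z ∈ openSegment ℝ a b ↔ ∃ t : ℝ, 0 < t ∧ t < 1 ∧
      z.1 = a.1 + t * (b.1 - a.1) ∧ z.2 = a.2 + t * (b.2 - a.2) := by
  constructor
  · rintro ⟨u, t, hu, ht, hut, rfl⟩
    obtain rfl : u = 1 - t := by linarith
    refine ⟨t, ht, by linarith, ?_, ?_⟩ <;> simp <;> ring
  · rintro ⟨t, h0, h1, hz1, hz2⟩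
    refine ⟨1 - t, t, by linarith, h0, by ring, ?_⟩
    ext
    · simp [hz1]; ring
    · simp [hz2]; ring

lemma collinear_of_cr_eq_zero {p q r : Pt} (hpq : p ≠ q) (h : cr p q r = 0) :
    Collinear ℝ ({p, q, r} : Set Pt) := by
  rw [collinear_iff_of_mem (p₀ := p) (by simp)]
  refine ⟨q - p, ?_⟩
  have key : ∃ t : ℝ, r = t • (q - p) + p := by
    unfold cr at h
    by_cases h1 : q.1 = p.1
    · have h2 : q.2 - p.2 ≠ 0 := fun h2 => hpq (Prod.ext h1.symm (by linarith))
      refine ⟨(r.2 - p.2) / (q.2 - p.2), ?_⟩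
      have h3 : r.1 - p.1 = 0 := by
        rw [h1] at h
        have : (q.2 - p.2) * (r.1 - p.1) = 0 := by linarith
        exact (mul_eq_zero.1 this).resolve_left h2
      ext
      · simp [h1]; linarith
      · simp; field_simp; ring
    · have h2 : q.1 - p.1 ≠ 0 := sub_ne_zero.2 h1
      refine ⟨(r.1 - p.1) / (q.1 - p.1), ?_⟩
      ext
      · simp; field_simp; ring
      · simp; field_simp; linarith
  obtain ⟨t, ht⟩ := key
  intro x hx
  simp only [Set.mem_insert_iff, Set.mem_singleton_iff] at hx
  rcases hx with rfl | rfl | rfl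
  · exact ⟨0, by simp⟩
  · exact ⟨1, by simp⟩
  · exact ⟨t, by simpa using ht⟩

lemma GenPos.cr_ne_zero {S : Finset Pt} (h : GenPos S) {p q r : Pt} (hp : p ∈ S) (hq : q ∈ S)
    (hr : r ∈ S) (hpq : p ≠ q) (hpr : p ≠ r) (hqr : q ≠ r) : cr p q r ≠ 0 := fun h0 =>
  h p hp q hq r hr hpq hpr hqr (collinear_of_cr_eq_zero hpq h0)

lemma GenPos.eq_or_eq {S : Finset Pt} (h : GenPos S) {p q r : Pt} (hp : p ∈ S) (hq : q ∈ S)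
    (hr : r ∈ S) (hpq : p ≠ q) (h0 : cr p q r = 0) : r = p ∨ r = q := by
  by_contra hne
  push Not at hne
  exact h.cr_ne_zero hp hq hr hpq hne.1.symm hne.2.symm h0

lemma edgesCross_mk {a b c d : Pt} :
    EdgesCross s(a, b) s(c, d) ↔ (openSegment ℝ a b ∩ openSegment ℝ c d).Nonempty := by
  constructor
  · rintro ⟨a', b', c', d', h1, h2, h⟩
    rw [Sym2.eq_iff] at h1 h2
    rcases h1 with ⟨rfl, rfl⟩ | ⟨rfl, rfl⟩ <;> rcases h2 with ⟨rfl, rfl⟩ | ⟨rfl, rfl⟩ <;>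
      simpa only [openSegment_symm ℝ b a, openSegment_symm ℝ d c] using h
  · exact fun h => ⟨a, b, c, d, rfl, rfl, h⟩

lemma EdgesCross.symm {e f : Sym2 Pt} (h : EdgesCross e f) : EdgesCross f e := by
  obtain ⟨a, b, c, d, rfl, rfl, h⟩ := h
  exact ⟨c, d, a, b, rfl, rfl, by rwa [Set.inter_comm]⟩

namespace IsPlaneGraph

variable {S : Finset Pt} {T : Finset (Sym2 Pt)} {a b c d z : Pt}

lemma left_mem (hT : IsPlaneGraph S T) (h : s(a, b) ∈ T) : a ∈ S :=
  (hT.1 _ h).2 a (by simp)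

lemma right_mem (hT : IsPlaneGraph S T) (h : s(a, b) ∈ T) : b ∈ S :=
  (hT.1 _ h).2 b (by simp)

lemma ne (hT : IsPlaneGraph S T) (h : s(a, b) ∈ T) : a ≠ b := by
  simpa using (hT.1 _ h).1

lemma eq_of_mem_openSegment (hT : IsPlaneGraph S T) (hab : s(a, b) ∈ T) (hcd : s(c, d) ∈ T)
    (h1 : z ∈ openSegment ℝ a b) (h2 : z ∈ openSegment ℝ c d) : s(a, b) = s(c, d) := by
  by_contra hne
  exact hT.2 _ hab _ hcd hne (edgesCross_mk.2 ⟨z, h1, h2⟩)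

lemma mono {H : Finset (Sym2 Pt)} (hT : IsPlaneGraph S T) (h : H ⊆ T) : IsPlaneGraph S H :=
  ⟨fun e he => hT.1 e (h he), fun e he f hf => hT.2 e (h he) f (h hf)⟩

end IsPlaneGraph

lemma mem_planeGraphs {S : Finset Pt} {T : Finset (Sym2 Pt)} :
    T ∈ planeGraphs S ↔ IsPlaneGraph S T := by
  simp only [planeGraphs, Finset.mem_filter, Finset.mem_powerset, and_iff_right_iff_imp]
  intro h e he
  rw [Finset.mem_sym2_iff]
  exact (h.1 e he).2

/-- If the edge `pq` cannot be added to the plane graph `T`, then some edge of `T` crosses it. -/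
lemma exists_cross_of_not_insert {S : Finset Pt} {T : Finset (Sym2 Pt)} (hT : IsPlaneGraph S T)
    {p q : Pt} (hp : p ∈ S) (hq : q ∈ S) (hpq : p ≠ q)
    (h : ¬ IsPlaneGraph S (insert s(p, q) T)) :
    ∃ c d, s(c, d) ∈ T ∧ (openSegment ℝ p q ∩ openSegment ℝ c d).Nonempty := by
  by_contra hcon
  push Not at hcon
  have hc : ∀ f ∈ T, ¬ EdgesCross s(p, q) f := by
    intro f hf
    induction f using Sym2.ind with
    | _ c d =>
      rw [edgesCross_mk, hcon c d hf]
      simp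
  refine h ⟨?_, ?_⟩
  · intro e he
    rcases Finset.mem_insert.1 he with rfl | he
    · refine ⟨by simpa using hpq, ?_⟩
      intro x hx
      rcases Sym2.mem_iff.1 hx with rfl | rfl <;> assumption
    · exact hT.1 e he
  · intro e he f hf hne
    rcases Finset.mem_insert.1 he with rfl | he <;> rcases Finset.mem_insert.1 hf with rfl | hf
    · exact absurd rfl hne
    · exact hc f hf
    · exact fun hx => hc e he hx.symm
    · exact hT.2 e he f hf hne

/-- The height at abscissa `x` of the line through `a` and `b`, in the sheared coordinates
`(p.1 + t * p.2, p.2)`. -/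
def ht (X : Pt → ℝ) (a b : Pt) (x : ℝ) : ℝ := a.2 + (b.2 - a.2) / (X b - X a) * (x - X a)

lemma ht_left (X : Pt → ℝ) (a b : Pt) : ht X a b (X a) = a.2 := by simp [ht]

lemma ht_right {X : Pt → ℝ} {a b : Pt} (h : X a < X b) : ht X a b (X b) = b.2 := by
  have : X b - X a ≠ 0 := by linarith
  simp only [ht]; field_simp; ring

lemma continuous_ht (X : Pt → ℝ) (a b : Pt) : Continuous (ht X a b) := by
  unfold ht; fun_prop

lemma mem_openSegment_ht {t : ℝ} {X : Pt → ℝ} (hX : ∀ p, X p = p.1 + t * p.2) {a b : Pt} {x : ℝ}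
    (h1 : X a < x) (h2 : x < X b) :
    ((x - t * ht X a b x, ht X a b x) : Pt) ∈ openSegment ℝ a b := by
  have hne : X b - X a ≠ 0 := by linarith
  rw [mem_openSegment_iff_coords]
  refine ⟨(x - X a) / (X b - X a), div_pos (by linarith) (by linarith),
    (div_lt_one (by linarith)).2 (by linarith), ?_, ?_⟩
  · have e : x = X a + (x - X a) / (X b - X a) * (X b - X a) := by field_simp; ring
    have e2 : (b.2 - a.2) / (X b - X a) * (x - X a)
      = (x - X a) / (X b - X a) * (b.2 - a.2) := by ring
    simp only [ht, e2]
    generalize (x - X a) / (X b - X a) = u at *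
    rw [e, hX a, hX b]
    ring
  · simp only [ht]; ring

lemma cr_eq_zero_of_ht {t : ℝ} {X : Pt → ℝ} (hX : ∀ p, X p = p.1 + t * p.2) {a b s : Pt}
    (h : X a < X b) (hs : ht X a b (X s) = s.2) : cr a b s = 0 := by
  have hne : X b - X a ≠ 0 := by linarith
  have h1 : (s.2 - a.2) * (X b - X a) = (b.2 - a.2) * (X s - X a) := by
    rw [← hs]; simp only [ht]; field_simp; ring
  rw [hX, hX, hX] at h1
  unfold cr
  linear_combination h1

lemma exists_injOn_shear (S : Finset Pt) :
    ∃ t : ℝ, ∀ p ∈ S, ∀ q ∈ S, p.1 + t * p.2 = q.1 + t * q.2 → p = q := by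
  obtain ⟨t, ht⟩ := Infinite.exists_notMem_finset
    ((S ×ˢ S).image fun pq : Pt × Pt => -(pq.1.1 - pq.2.1) / (pq.1.2 - pq.2.2))
  refine ⟨t, fun p hp q hq h => ?_⟩
  by_cases h2 : p.2 = q.2
  · rw [h2] at h
    exact Prod.ext (by linarith) h2
  · refine absurd (Finset.mem_image.2 ⟨(p, q), Finset.mem_product.2 ⟨hp, hq⟩, ?_⟩) ht
    have : p.2 - q.2 ≠ 0 := sub_ne_zero.2 h2
    simp only
    field_simp
    linarith

/-- `v` is the first vertex met by the sweep line inside the wedge between the consecutive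
edges `ac` (below) and `ab` (above), whose common left endpoint is `a`. -/
structure Wedge (S : Finset Pt) (T : Finset (Sym2 Pt)) (X : Pt → ℝ) (a b c v : Pt) : Prop where
  memab : s(a, b) ∈ T
  memac : s(a, c) ∈ T
  memv : v ∈ S
  left : X a < X v
  leb : X v ≤ X b
  lec : X v ≤ X c
  above : v.2 ≤ ht X a b (X v)
  below : ht X a c (X v) ≤ v.2
  consec : ∀ b', s(a, b') ∈ T → X a < X b' →
    ht X a c (X v) < ht X a b' (X v) → ht X a b (X v) ≤ ht X a b' (X v)
  first : ∀ s ∈ S, X a < X s → ht X a c (X s) ≤ s.2 → s.2 ≤ ht X a b (X s) → X v ≤ X s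

section Sweep

variable {S : Finset Pt} {T : Finset (Sym2 Pt)} {t : ℝ} {X : Pt → ℝ}

lemma ht_ne (hT : IsPlaneGraph S T) (hX : ∀ p, X p = p.1 + t * p.2) {a b c d : Pt} {x : ℝ}
    (hab : s(a, b) ∈ T) (hcd : s(c, d) ∈ T) (hac : a ≠ c ∨ b ≠ d) (h1 : X a < x) (h2 : x < X b)
    (h3 : X c < x) (h4 : x < X d) : ht X a b x ≠ ht X c d x := by
  intro h
  have m1 := mem_openSegment_ht hX h1 h2
  have m2 := mem_openSegment_ht hX h3 h4
  rw [← h] at m2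
  have := hT.eq_of_mem_openSegment hab hcd m1 m2
  rcases Sym2.eq_iff.1 this with ⟨rfl, rfl⟩ | ⟨rfl, rfl⟩
  · simp at hac
  · linarith

lemma ht_not_swap (hT : IsPlaneGraph S T) (hX : ∀ p, X p = p.1 + t * p.2) {a b c d : Pt}
    {l r : ℝ} (hab : s(a, b) ∈ T) (hcd : s(c, d) ∈ T) (hac : a ≠ c ∨ b ≠ d)
    (hlr : l < r) (h1 : X a ≤ l) (h2 : r ≤ X b) (h3 : X c ≤ l) (h4 : r ≤ X d)
    (hl : ht X a b l < ht X c d l) (hr : ht X c d r < ht X a b r) : False := by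
  have hc : ContinuousOn (fun x => ht X a b x - ht X c d x) (Set.Icc l r) :=
    ((continuous_ht X a b).sub (continuous_ht X c d)).continuousOn
  obtain ⟨x, ⟨hx1, hx2⟩, hx⟩ := intermediate_value_Ioo hlr.le hc
    (show (0 : ℝ) ∈ Set.Ioo _ _ from ⟨by linarith, by linarith⟩)
  simp only at hx
  exact ht_ne hT hX (x := x) hab hcd hac (by linarith) (by linarith) (by linarith) (by linarith)
    (by linarith)

lemma Wedge.free (hS : GenPos S) (hT : IsPlaneGraph S T) (hX : ∀ p, X p = p.1 + t * p.2)
    (hinj : ∀ p ∈ S, ∀ q ∈ S, X p = X q → p = q) {a b c v a' b' : Pt}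
    (w : Wedge S T X a b c v) (h : s(a', b') ∈ T) (h1 : X a' < X v) (h2 : X v < X b')
    (hlo : ht X a c (X v) < ht X a' b' (X v)) (hhi : ht X a' b' (X v) < ht X a b (X v)) :
    False := by
  have ha := hT.left_mem w.memab
  have ha' := hT.left_mem h
  have hl := w.left
  rcases lt_trichotomy (X a') (X a) with hlt | heq | hgt
  · have hne : a' ≠ a := by rintro rfl; exact lt_irrefl _ hlt
    rcases lt_trichotomy (ht X a' b' (X a)) a.2 with h3 | h3 | h3
    · refine ht_not_swap hT hX h w.memac (Or.inl hne) hl hlt.le h2.le le_rfl w.lec ?_ hlo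
      rwa [ht_left]
    · refine hS.cr_ne_zero ha' (hT.right_mem h) ha (hT.ne h) hne ?_
        (cr_eq_zero_of_ht hX (by linarith) h3)
      rintro rfl
      linarith
    · refine ht_not_swap hT hX w.memab h (Or.inl hne.symm) hl le_rfl w.leb hlt.le h2.le ?_ hhi
      rwa [ht_left]
  · obtain rfl := hinj _ ha' _ ha heq
    have := w.consec b' h (by linarith) hlo
    linarith
  · have hne : a ≠ a' := by rintro rfl; exact lt_irrefl _ hgt
    have hlec := w.lec
    have hleb := w.leb
    by_cases h3 : ht X a c (X a') ≤ a'.2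
    · by_cases h4 : a'.2 ≤ ht X a b (X a')
      · have := w.first a' ha' hgt h3 h4
        linarith
      · refine ht_not_swap hT hX w.memab h (Or.inl hne) h1 hgt.le hleb le_rfl h2.le ?_ hhi
        rw [ht_left]; linarith
    · refine ht_not_swap hT hX h w.memac (Or.inl hne.symm) h1 le_rfl h2.le hgt.le hlec ?_ hlo
      rw [ht_left]; linarith

/-- The charging of the edge `d.1 d.2` to a vertex, in one of three ways. -/
def Charge (S : Finset Pt) (T : Finset (Sym2 Pt)) (X : Pt → ℝ) (d : Pt × Pt) (vk : Pt × Fin 3) :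
    Prop :=
  (vk.2 = 0 ∧ vk.1 = d.1 ∧ ∀ b', s(d.1, b') ∈ T → X d.1 < X b' →
      (d.2.2 - d.1.2) / (X d.2 - X d.1) ≤ (b'.2 - d.1.2) / (X b' - X d.1)) ∨
    (vk.2 = 1 ∧ X vk.1 < X d.2 ∧ vk.1.2 < ht X d.1 d.2 (X vk.1) ∧
      ∃ c, Wedge S T X d.1 d.2 c vk.1) ∨
    (vk.2 = 2 ∧ vk.1 = d.2 ∧ ∃ c, X d.2 < X c ∧ Wedge S T X d.1 d.2 c vk.1)

lemma ht_lt_ht_iff {a b c : Pt} {x : ℝ} (hx : X a < x) :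
    ht X a b x < ht X a c x ↔
      (b.2 - a.2) / (X b - X a) < (c.2 - a.2) / (X c - X a) := by
  simp only [ht, add_lt_add_iff_left]
  exact mul_lt_mul_iff_left₀ (by linarith)

lemma ht_le_ht_iff {a b c : Pt} {x : ℝ} (hx : X a < x) :
    ht X a b x ≤ ht X a c x ↔
      (b.2 - a.2) / (X b - X a) ≤ (c.2 - a.2) / (X c - X a) := by
  simp only [ht, add_le_add_iff_left]
  exact mul_le_mul_iff_left₀ (by linarith)

lemma eq_of_slope_eq (hS : GenPos S) (hT : IsPlaneGraph S T) (hX : ∀ p, X p = p.1 + t * p.2)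
    {a b c : Pt} (hab : s(a, b) ∈ T) (hac : s(a, c) ∈ T) (h1 : X a < X b) (h2 : X a < X c)
    (h : (b.2 - a.2) / (X b - X a) = (c.2 - a.2) / (X c - X a)) : b = c := by
  have : ht X a b (X c) = c.2 := by
    rw [← ht_right h2]
    simp only [ht, h]
  rcases hS.eq_or_eq (hT.left_mem hab) (hT.right_mem hab) (hT.right_mem hac) (hT.ne hab)
    (cr_eq_zero_of_ht hX h1 this) with rfl | rfl
  · exact absurd rfl (hT.ne hac)
  · rfl

lemma exists_charge (hS : GenPos S) (hT : IsPlaneGraph S T) (hX : ∀ p, X p = p.1 + t * p.2)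
    (hinj : ∀ p ∈ S, ∀ q ∈ S, X p = X q → p = q) {a b : Pt} (hab : s(a, b) ∈ T)
    (hlt : X a < X b) : ∃ vk ∈ S ×ˢ (Finset.univ : Finset (Fin 3)), Charge S T X (a, b) vk := by
  have ha := hT.left_mem hab
  have hb := hT.right_mem hab
  by_cases hlow : ∀ b', s(a, b') ∈ T → X a < X b' →
      (b.2 - a.2) / (X b - X a) ≤ (b'.2 - a.2) / (X b' - X a)
  · exact ⟨(a, 0), by simp [ha], Or.inl ⟨rfl, rfl, hlow⟩⟩
  push Not at hlow
  obtain ⟨c₀, hc₀, hc₀X, hc₀s⟩ := hlow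
  obtain ⟨c, hc, hcmax⟩ := Finset.exists_max_image
    (S.filter fun c => s(a, c) ∈ T ∧ X a < X c ∧
      (c.2 - a.2) / (X c - X a) < (b.2 - a.2) / (X b - X a))
    (fun c => (c.2 - a.2) / (X c - X a))
    ⟨c₀, Finset.mem_filter.2 ⟨hT.right_mem hc₀, hc₀, hc₀X, hc₀s⟩⟩
  obtain ⟨hcS, hac, hcX, hcs⟩ := Finset.mem_filter.1 hc
  obtain ⟨v, hv, hvmin⟩ := Finset.exists_min_image
    (S.filter fun s => X a < X s ∧ ht X a c (X s) ≤ s.2 ∧ s.2 ≤ ht X a b (X s)) X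
    ⟨b, Finset.mem_filter.2 ⟨hb, hlt, by
      rw [← ht_right hlt]; exact ((ht_lt_ht_iff hlt).2 hcs).le, (ht_right hlt).ge⟩⟩
  obtain ⟨hvS, hvX, hv1, hv2⟩ := Finset.mem_filter.1 hv
  have hw : Wedge S T X a b c v :=
    { memab := hab
      memac := hac
      memv := hvS
      left := hvX
      leb := hvmin b (Finset.mem_filter.2 ⟨hb, hlt, by
        rw [← ht_right hlt]; exact ((ht_lt_ht_iff hlt).2 hcs).le, (ht_right hlt).ge⟩)
      lec := hvmin c (Finset.mem_filter.2 ⟨hcS, hcX, (ht_right hcX).le, by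
        rw [← ht_right hcX]; exact ((ht_lt_ht_iff hcX).2 hcs).le⟩)
      above := hv2
      below := hv1
      consec := by
        intro b' hb' hb'X h
        rw [ht_lt_ht_iff hvX] at h
        rw [ht_le_ht_iff hvX]
        by_contra hcon
        push Not at hcon
        have := hcmax b' (Finset.mem_filter.2 ⟨hT.right_mem hb', hb', hb'X, hcon⟩)
        linarith
      first := fun s hs h1 h2 h3 => hvmin s (Finset.mem_filter.2 ⟨hs, h1, h2, h3⟩) }
  by_cases hvb : v = b
  · subst hvb
    refine ⟨(v, 2), by simp [hvS], Or.inr (Or.inr ⟨rfl, rfl, c, ?_, hw⟩)⟩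
    refine lt_of_le_of_ne hw.lec fun h => ?_
    obtain rfl := hinj _ hvS _ hcS h
    exact lt_irrefl _ hcs
  · refine ⟨(v, 1), by simp [hvS], Or.inr (Or.inl ⟨rfl, ?_, ?_, c, hw⟩)⟩
    · exact lt_of_le_of_ne hw.leb fun h => hvb (hinj _ hvS _ hb h)
    · refine lt_of_le_of_ne hv2 fun h => ?_
      rcases hS.eq_or_eq ha hb hvS (hT.ne hab) (cr_eq_zero_of_ht hX hlt h.symm) with h' | h'
      · rw [h'] at hvX; exact lt_irrefl _ hvX
      · exact hvb h'

lemma charge_injective (hS : GenPos S) (hT : IsPlaneGraph S T) (hX : ∀ p, X p = p.1 + t * p.2)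
    (hinj : ∀ p ∈ S, ∀ q ∈ S, X p = X q → p = q) {d d' : Pt × Pt} {vk : Pt × Fin 3}
    (hd : s(d.1, d.2) ∈ T) (hd' : s(d'.1, d'.2) ∈ T) (hlt : X d.1 < X d.2)
    (hlt' : X d'.1 < X d'.2) (h : Charge S T X d vk) (h' : Charge S T X d' vk) : d = d' := by
  obtain ⟨a, b⟩ := d
  obtain ⟨a', b'⟩ := d'
  obtain ⟨v, k⟩ := vk
  simp only [Charge] at h h' hd hd' hlt hlt'
  rcases h with ⟨rfl, h⟩ | ⟨rfl, h⟩ | ⟨rfl, h⟩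
  · obtain ⟨rfl, h1⟩ := h'.resolve_right (by simp) |>.2
    obtain ⟨rfl, h2⟩ := h
    rw [eq_of_slope_eq hS hT hX hd hd' hlt hlt'
      (le_antisymm (h2 _ hd' hlt') (h1 _ hd hlt))]
  · obtain ⟨h1', h2', c', w'⟩ : X v < X b' ∧ v.2 < ht X a' b' (X v) ∧
      ∃ c, Wedge S T X a' b' c v := by simpa using h'
    obtain ⟨h1, h2, c, w⟩ := h
    by_contra hne
    have hne' : a ≠ a' ∨ b ≠ b' := by
      by_contra hcon
      push Not at hcon
      exact hne (Prod.ext hcon.1 hcon.2)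
    rcases lt_or_gt_of_ne (ht_ne hT hX hd hd' hne' w.left h1 w'.left h1') with h3 | h3
    · exact w'.free hS hT hX hinj hd w.left h1 (w'.below.trans_lt h2) h3
    · exact w.free hS hT hX hinj hd' w'.left h1' (w.below.trans_lt h2') h3
  · obtain ⟨rfl, c', h1', w'⟩ : v = b' ∧ ∃ c, X b' < X c ∧ Wedge S T X a' b' c v := by
      simpa using h'
    obtain ⟨rfl, c, h1, w⟩ := h
    by_contra hne
    have hne' : a ≠ a' := fun h => hne (by rw [h])
    have key : ∀ {a c : Pt}, s(a, v) ∈ T → Wedge S T X a v c v → X v < X c →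
        ht X a c (X v) < ht X a v (X v) := by
      intro a c hav w hc
      rw [ht_right w.left]
      refine lt_of_le_of_ne w.below fun h => ?_
      rcases hS.eq_or_eq (hT.left_mem hav) (hT.right_mem w.memac) (hT.right_mem hav)
        (hT.ne w.memac) (cr_eq_zero_of_ht hX (w.left.trans hc) h) with h' | h'
      · exact hT.ne hav h'.symm
      · rw [h'] at hc; exact lt_irrefl _ hc
    have k1 := key hd w h1
    have k2 := key hd' w' h1'
    rw [ht_right hlt] at k1
    rw [ht_right hlt'] at k2
    rcases lt_or_gt_of_ne (ht_ne hT hX w.memac w'.memac (Or.inl hne') w.left h1 w'.left h1')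
      with h3 | h3
    · exact w.free hS hT hX hinj w'.memac w'.left h1' h3 (by rwa [ht_right hlt])
    · exact w'.free hS hT hX hinj w.memac w.left h1 h3 (by rwa [ht_right hlt'])

/-- A plane graph on `N` points in general position has at most `3 N` edges. -/
theorem card_le_three_mul (hS : GenPos S) (hT : IsPlaneGraph S T) : T.card ≤ 3 * S.card := by
  obtain ⟨t, hinj⟩ := exists_injOn_shear S
  obtain ⟨X, hX⟩ : ∃ X : Pt → ℝ, ∀ p, X p = p.1 + t * p.2 := ⟨_, fun _ => rfl⟩
  simp only [← hX] at hinj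
  set D := (S ×ˢ S).filter fun d : Pt × Pt => s(d.1, d.2) ∈ T ∧ X d.1 < X d.2 with hD
  have h1 : T.card ≤ D.card := by
    refine Finset.card_le_card_of_surjOn (fun d : Pt × Pt => s(d.1, d.2)) ?_
    intro e he
    induction e using Sym2.ind with
    | _ a b =>
      have he : s(a, b) ∈ T := he
      have ha := hT.left_mem he
      have hb := hT.right_mem he
      rcases lt_trichotomy (X a) (X b) with h | h | h
      · exact ⟨(a, b), by simp [hD, ha, hb, he, h], rfl⟩
      · exact absurd (hinj a ha b hb h) (hT.ne he)
      · exact ⟨(b, a), by simp [hD, ha, hb, Sym2.eq_swap, he, h], Sym2.eq_swap⟩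
  have h2 : D.card ≤ (S ×ˢ (Finset.univ : Finset (Fin 3))).card := by
    refine Finset.card_le_card_of_forall_subsingleton (Charge S T X) ?_ ?_
    · rintro ⟨a, b⟩ hd
      obtain ⟨-, hab, hlt⟩ := Finset.mem_filter.1 hd
      exact exists_charge hS hT hX hinj hab hlt
    · rintro vk - d ⟨hd, hc⟩ d' ⟨hd', hc'⟩
      obtain ⟨-, hab, hlt⟩ := Finset.mem_filter.1 hd
      obtain ⟨-, hab', hlt'⟩ := Finset.mem_filter.1 hd'
      exact charge_injective hS hT hX hinj hab hab' hlt hlt' hc hc'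
  rw [Finset.card_product, Finset.card_univ, Fintype.card_fin] at h2
  omega

end Sweep

/-- Affine coordinates: `w = p + coord p a b w • (a - p) + coord p b a w • (b - p)`. -/
def coord (p a b w : Pt) : ℝ := cr p w b / cr p a b

lemma cr_swap (p a b : Pt) : cr p b a = - cr p a b := by unfold cr; ring

lemma coord_left {p a b : Pt} (h : cr p a b ≠ 0) : coord p a b a = 1 := div_self h

lemma coord_right (p a b : Pt) : coord p a b b = 0 := by
  have : cr p b b = 0 := by unfold cr; ring
  simp [coord, this]

lemma coord_base (p a b : Pt) : coord p a b p = 0 := by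
  have : cr p p b = 0 := by unfold cr; ring
  simp [coord, this]

lemma coord_affine {p a b y c z : Pt} {μ : ℝ} (h1 : z.1 = y.1 + μ * (c.1 - y.1))
    (h2 : z.2 = y.2 + μ * (c.2 - y.2)) :
    coord p a b z = coord p a b y + μ * (coord p a b c - coord p a b y) := by
  have : cr p z b = cr p y b + μ * (cr p c b - cr p y b) := by
    unfold cr; rw [h1, h2]; ring
  simp only [coord, this]
  ring

lemma fst_eq_coord {p a b : Pt} (h : cr p a b ≠ 0) (w : Pt) :
    w.1 = p.1 + coord p a b w * (a.1 - p.1) + coord p b a w * (b.1 - p.1) := by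
  simp only [coord, cr_swap p a b]
  field_simp
  unfold cr
  ring

lemma snd_eq_coord {p a b : Pt} (h : cr p a b ≠ 0) (w : Pt) :
    w.2 = p.2 + coord p a b w * (a.2 - p.2) + coord p b a w * (b.2 - p.2) := by
  simp only [coord, cr_swap p a b]
  field_simp
  unfold cr
  ring

lemma cr_eq_coord {p a b : Pt} (h : cr p a b ≠ 0) (u v w : Pt) :
    cr u v w = cr p a b *
      ((coord p a b v - coord p a b u) * (coord p b a w - coord p b a u) -
        (coord p b a v - coord p b a u) * (coord p a b w - coord p a b u)) := by
  unfold cr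
  rw [fst_eq_coord h u, fst_eq_coord h v, fst_eq_coord h w,
    snd_eq_coord h u, snd_eq_coord h v, snd_eq_coord h w]
  ring

lemma mem_openSegment_of_coord {p a b u v z : Pt} {μ : ℝ} (h : cr p a b ≠ 0) (h0 : 0 < μ)
    (h1 : μ < 1)
    (hz1 : coord p a b z = coord p a b u + μ * (coord p a b v - coord p a b u))
    (hz2 : coord p b a z = coord p b a u + μ * (coord p b a v - coord p b a u)) :
    z ∈ openSegment ℝ u v := by
  rw [mem_openSegment_iff_coords]
  refine ⟨μ, h0, h1, ?_, ?_⟩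
  · rw [fst_eq_coord h u, fst_eq_coord h v, fst_eq_coord h z, hz1, hz2]; ring
  · rw [snd_eq_coord h u, snd_eq_coord h v, snd_eq_coord h z, hz1, hz2]; ring

lemma mem_openSegment_of_coord_add_eq_one {p a b z : Pt} (h : cr p a b ≠ 0)
    (h1 : 0 < coord p a b z) (h2 : 0 < coord p b a z)
    (h3 : coord p a b z + coord p b a z = 1) : z ∈ openSegment ℝ a b := by
  have h' : cr p b a ≠ 0 := by rw [cr_swap]; exact neg_ne_zero.2 h
  refine mem_openSegment_of_coord h h2 (by linarith) ?_ ?_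
  · rw [coord_left h, coord_right]; linarith
  · rw [coord_left h', coord_right]; ring

/-- The point with prescribed affine coordinates on the segment from `y` to `c`. -/
lemma exists_point (y c : Pt) (μ : ℝ) :
    ∃ z : Pt, z.1 = y.1 + μ * (c.1 - y.1) ∧ z.2 = y.2 + μ * (c.2 - y.2) :=
  ⟨(_, _), rfl, rfl⟩

lemma cone_pos {q1 q2 r1 r2 z1 z2 : ℝ} (hq1 : 0 < q1) (hr1 : 0 < r1) (hr2 : 0 ≤ r2)
    (hrq : r2 * q1 < r1 * q2) (h1 : z1 * r2 < z2 * r1) (h2 : z2 * q1 ≤ z1 * q2) :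
    0 < z1 ∧ 0 < z2 := by
  have h3 : 0 < z1 * (r1 * q2 - r2 * q1) := by nlinarith
  have hz1 : 0 < z1 := pos_of_mul_pos_left h3 (by linarith)
  refine ⟨hz1, ?_⟩
  have : 0 < z2 * r1 := by nlinarith
  exact pos_of_mul_pos_left this hr1.le

lemma exit_side {q1 q2 r1 r2 y1 y2 c1 c2 : ℝ} (hq1 : 0 < q1) (hr1 : 0 < r1) (hr2 : 0 ≤ r2)
    (hrq : r2 * q1 < r1 * q2) (hy1 : y2 * q1 < y1 * q2) (hy2 : y1 * r2 ≤ y2 * r1)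
    (hy3 : y1 + y2 < 1) (hc1 : c1 * r2 < c2 * r1) (hc2 : c2 * q1 ≤ c1 * q2)
    (hc3 : 1 < c1 + c2) :
    ∃ μ, 0 < μ ∧ μ < 1 ∧ 0 < y1 + μ * (c1 - y1) ∧ 0 < y2 + μ * (c2 - y2) ∧
      (y1 + μ * (c1 - y1)) + (y2 + μ * (c2 - y2)) = 1 := by
  have hd : 0 < c1 + c2 - (y1 + y2) := by linarith
  obtain ⟨μ, hμ⟩ : ∃ μ, μ = (1 - (y1 + y2)) / (c1 + c2 - (y1 + y2)) := ⟨_, rfl⟩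
  have h0 : 0 < μ := by rw [hμ]; exact div_pos (by linarith) hd
  have h1 : μ < 1 := by rw [hμ, div_lt_one hd]; linarith
  have h2 : μ * (c1 + c2 - (y1 + y2)) = 1 - (y1 + y2) := by rw [hμ]; field_simp
  obtain ⟨p1, p2⟩ := cone_pos (z1 := y1 + μ * (c1 - y1)) (z2 := y2 + μ * (c2 - y2))
    hq1 hr1 hr2 hrq (by nlinarith) (by nlinarith)
  exact ⟨μ, h0, h1, p1, p2, by linarith⟩

lemma exit_cases {q1 q2 r1 r2 y1 y2 c1 c2 : ℝ} (hq1 : 0 < q1) (hr1 : 0 < r1) (hr2 : 0 ≤ r2)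
    (hrq : r2 * q1 < r1 * q2) (hy1 : y2 * q1 < y1 * q2) (hy2 : y1 * r2 ≤ y2 * r1)
    (hy3 : y1 + y2 < 1) (hc1 : c1 * r2 < c2 * r1) :
    (0 < c1 ∧ 0 < c2 ∧ c1 + c2 ≤ 1 ∧ c2 * q1 ≤ c1 * q2) ∨
    (∃ μ, 0 < μ ∧ μ < 1 ∧ 0 < y1 + μ * (c1 - y1) ∧ 0 < y2 + μ * (c2 - y2) ∧
      (y1 + μ * (c1 - y1)) + (y2 + μ * (c2 - y2)) = 1) ∨
    (∃ μ τ, 0 < μ ∧ μ < 1 ∧ 0 < τ ∧ τ * (q1 + q2) ≤ 1 ∧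
      y1 + μ * (c1 - y1) = τ * q1 ∧ y2 + μ * (c2 - y2) = τ * q2) := by
  rcases le_or_gt (c2 * q1) (c1 * q2) with hc | hc
  · obtain ⟨p1, p2⟩ := cone_pos hq1 hr1 hr2 hrq hc1 hc
    rcases le_or_gt (c1 + c2) 1 with h | h
    · exact Or.inl ⟨p1, p2, h, hc⟩
    · exact Or.inr (Or.inl (exit_side hq1 hr1 hr2 hrq hy1 hy2 hy3 hc1 hc h))
  · have hd : 0 < (y1 * q2 - y2 * q1) - (c1 * q2 - c2 * q1) := by linarith
    obtain ⟨μ, hμ⟩ : ∃ μ, μ =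
      (y1 * q2 - y2 * q1) / ((y1 * q2 - y2 * q1) - (c1 * q2 - c2 * q1)) := ⟨_, rfl⟩
    have h0 : 0 < μ := by rw [hμ]; exact div_pos (by linarith) hd
    have h1 : μ < 1 := by rw [hμ, div_lt_one hd]; linarith
    have h2 : μ * ((y1 * q2 - y2 * q1) - (c1 * q2 - c2 * q1)) = y1 * q2 - y2 * q1 := by
      rw [hμ, div_mul_cancel₀ _ hd.ne']
    have hz1 : (y1 + μ * (c1 - y1)) * r2 < (y2 + μ * (c2 - y2)) * r1 := by nlinarith
    have hz2 : (y2 + μ * (c2 - y2)) * q1 = (y1 + μ * (c1 - y1)) * q2 := by linarith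
    obtain ⟨p1, p2⟩ := cone_pos hq1 hr1 hr2 hrq hz1 hz2.le
    rcases le_or_gt ((y1 + μ * (c1 - y1)) + (y2 + μ * (c2 - y2))) 1 with h | h
    · refine Or.inr (Or.inr ⟨μ, (y1 + μ * (c1 - y1)) / q1, h0, h1, div_pos p1 hq1, ?_, ?_, ?_⟩)
      · have : (y1 + μ * (c1 - y1)) / q1 * (q1 + q2) =
          (y1 + μ * (c1 - y1)) + (y2 + μ * (c2 - y2)) := by
          field_simp; linarith
        rw [this]; exact h
      · field_simp
      · field_simp; linarith
    · obtain ⟨ν, n0, n1, n2, n3, n4⟩ :=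
        exit_side hq1 hr1 hr2 hrq hy1 hy2 hy3 hz1 hz2.le h
      refine Or.inr (Or.inl ⟨ν * μ, by positivity, by nlinarith, ?_, ?_, ?_⟩)
      · linarith
      · linarith
      · linarith

/-- `ab` is the edge of `T` crossing the segment `pq` nearest to `p`. -/
structure Nearest (S : Finset Pt) (T : Finset (Sym2 Pt)) (p q a b : Pt) : Prop where
  memp : p ∈ S
  memq : q ∈ S
  ne : p ≠ q
  notMem : s(p, q) ∉ T
  memab : s(a, b) ∈ T
  cr_ne : cr p a b ≠ 0
  pos_left : 0 < coord p a b q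
  pos_right : 0 < coord p b a q
  one_lt : 1 < coord p a b q + coord p b a q
  near : ∀ c d z τ, s(c, d) ∈ T → s(c, d) ≠ s(a, b) → z ∈ openSegment ℝ c d → 0 < τ →
    coord p a b z = τ * coord p a b q → coord p b a z = τ * coord p b a q →
    τ * (coord p a b q + coord p b a q) ≤ 1 → False

/-- `r` is a point of the triangle `pab`, on the same side of `pq` as `a`, seen from `p` in the
direction closest to that of `q`. -/
structure Closest (S : Finset Pt) (p q a b r : Pt) : Prop where
  mem : r ∈ S
  left_pos : 0 < coord p a b r
  right_nonneg : 0 ≤ coord p b a r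
  add_le : coord p a b r + coord p b a r ≤ 1
  side : coord p b a r * coord p a b q < coord p a b r * coord p b a q
  min : ∀ w ∈ S, 0 < coord p a b w → 0 < coord p b a w → coord p a b w + coord p b a w ≤ 1 →
    coord p b a w * coord p a b q < coord p a b w * coord p b a q →
    coord p b a w * coord p a b r ≤ coord p a b w * coord p b a r

section Link

variable {S : Finset Pt} {T : Finset (Sym2 Pt)} {p q a b r s : Pt}

lemma Nearest.swap (h : Nearest S T p q a b) : Nearest S T p q b a where
  memp := h.memp
  memq := h.memq
  ne := h.ne
  notMem := h.notMem
  memab := by rw [Sym2.eq_swap]; exact h.memab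
  cr_ne := by rw [cr_swap]; exact neg_ne_zero.2 h.cr_ne
  pos_left := h.pos_right
  pos_right := h.pos_left
  one_lt := by rw [add_comm]; exact h.one_lt
  near := fun c d z τ h1 h2 h3 h4 h5 h6 h7 =>
    h.near c d z τ h1 (by rwa [Sym2.eq_swap (a := a)]) h3 h4 h6 h5 (by rwa [add_comm])

lemma Nearest.exists_closest (hT : IsPlaneGraph S T) (h : Nearest S T p q a b) :
    ∃ r, Closest S p q a b r := by
  have hb := h.pos_right
  have ha := h.pos_left
  obtain ⟨r, hr, hmax⟩ := Finset.exists_max_image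
    (S.filter fun w => 0 < coord p a b w ∧ 0 ≤ coord p b a w ∧
      coord p a b w + coord p b a w ≤ 1 ∧
      coord p b a w * coord p a b q < coord p a b w * coord p b a q)
    (fun w => coord p b a w / coord p a b w)
    ⟨a, Finset.mem_filter.2 ⟨hT.left_mem h.memab, by
      rw [coord_left h.cr_ne, coord_right]
      norm_num
      exact hb⟩⟩
  obtain ⟨hrS, h1, h2, h3, h4⟩ := Finset.mem_filter.1 hr
  refine ⟨r, hrS, h1, h2, h3, h4, fun w hw w1 w2 w3 w4 => ?_⟩
  have := hmax w (Finset.mem_filter.2 ⟨hw, w1, w2.le, w3, w4⟩)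
  rw [div_le_div_iff₀ w1 h1] at this
  linarith

lemma Nearest.eq_of_coord_mul_eq (hS : GenPos S) (h : Nearest S T p q a b) {w : Pt} (hw : w ∈ S)
    (he : coord p b a w * coord p a b q = coord p a b w * coord p b a q) : w = p ∨ w = q := by
  refine hS.eq_or_eq h.memp h.memq hw h.ne ?_
  rw [cr_eq_coord h.cr_ne, coord_base, coord_base]
  linear_combination cr p a b * he

/-- An edge leaving the region between the rays `pr` and `pq`, in front of `ab`, can only do so
through the ray `pr`. -/
lemma Nearest.no_exit (hS : GenPos S) (hT : IsPlaneGraph S T) (h : Nearest S T p q a b)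
    (hr : Closest S p q a b r) {c d y : Pt} (hcd : s(c, d) ∈ T) (hy : y ∈ openSegment ℝ c d)
    (hy1 : coord p b a y * coord p a b q < coord p a b y * coord p b a q)
    (hy2 : coord p a b y * coord p b a r ≤ coord p b a y * coord p a b r)
    (hy3 : coord p a b y + coord p b a y < 1) :
    coord p b a c * coord p a b r ≤ coord p a b c * coord p b a r := by
  by_contra hc
  push Not at hc
  have hD := h.cr_ne
  have hD' : cr p b a ≠ 0 := h.swap.cr_ne
  have hsub : ∀ z : Pt, ∀ μ : ℝ, 0 < μ → μ < 1 → z.1 = y.1 + μ * (c.1 - y.1) →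
      z.2 = y.2 + μ * (c.2 - y.2) → z ∈ openSegment ℝ c d := by
    intro z μ h0 h1 hz1 hz2
    obtain ⟨t, t0, t1, e1, e2⟩ := mem_openSegment_iff_coords.1 hy
    refine mem_openSegment_iff_coords.2 ⟨t * (1 - μ), ?_, ?_, ?_, ?_⟩
    · exact mul_pos t0 (by linarith)
    · nlinarith
    · rw [hz1, e1]; ring
    · rw [hz2, e2]; ring
  have hne : s(c, d) ≠ s(a, b) := by
    intro he
    have hy' : y ∈ openSegment ℝ a b := by
      rcases Sym2.eq_iff.1 he with ⟨rfl, rfl⟩ | ⟨rfl, rfl⟩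
      · exact hy
      · rwa [openSegment_symm]
    obtain ⟨t, -, -, e1, e2⟩ := mem_openSegment_iff_coords.1 hy'
    rw [coord_affine e1 e2, coord_affine e1 e2, coord_left hD, coord_left hD', coord_right,
      coord_right] at hy3
    linarith
  rcases exit_cases h.pos_left hr.left_pos hr.right_nonneg hr.side hy1 hy2 hy3 hc with
    ⟨c1, c2, c3, c4⟩ | ⟨μ, m0, m1, z1, z2, z3⟩ | ⟨μ, τ, m0, m1, t0, t1, z1, z2⟩
  · have hcS := hT.left_mem hcd
    rcases c4.lt_or_eq with c4 | c4
    · exact absurd (hr.min c hcS c1 c2 c3 c4) (not_le.2 hc)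
    · rcases h.eq_of_coord_mul_eq hS hcS c4 with rfl | rfl
      · rw [coord_base] at c1; exact lt_irrefl _ c1
      · have := h.one_lt; linarith
  · obtain ⟨z, e1, e2⟩ := exists_point y c μ
    rw [← coord_affine e1 e2] at z1 z3
    rw [← coord_affine e1 e2] at z2 z3
    exact hne (hT.eq_of_mem_openSegment hcd h.memab (hsub z μ m0 m1 e1 e2)
      (mem_openSegment_of_coord_add_eq_one hD z1 z2 z3))
  · obtain ⟨z, e1, e2⟩ := exists_point y c μ
    rw [← coord_affine e1 e2] at z1 z2
    exact h.near c d z τ hcd hne (hsub z μ m0 m1 e1 e2) t0 z1 z2 t1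

/-- `T` is a plane graph to which no edge can be added. -/
def Saturated (S : Finset Pt) (T : Finset (Sym2 Pt)) : Prop :=
  ∀ p ∈ S, ∀ q ∈ S, p ≠ q → s(p, q) ∉ T →
    ∃ c d, s(c, d) ∈ T ∧ (openSegment ℝ p q ∩ openSegment ℝ c d).Nonempty

lemma Nearest.mem_closest (hS : GenPos S) (hT : IsPlaneGraph S T) (hsat : Saturated S T)
    (h : Nearest S T p q a b) (hr : Closest S p q a b r) : s(p, r) ∈ T := by
  have hr1 := hr.left_pos
  have hr2 := hr.add_le
  have hr3 := hr.side
  by_contra hn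
  have hpr : p ≠ r := by
    rintro rfl
    rw [coord_base] at hr1
    exact lt_irrefl _ hr1
  obtain ⟨c, d, hcd, y, hy, hy'⟩ := hsat p h.memp r hr.mem hpr hn
  obtain ⟨t, t0, t1, e1, e2⟩ := mem_openSegment_iff_coords.1 hy
  have y1 := coord_affine (p := p) (a := a) (b := b) e1 e2
  have y2 := coord_affine (p := p) (a := b) (b := a) e1 e2
  rw [coord_base, sub_zero, zero_add] at y1 y2
  have k1 : coord p b a y * coord p a b q < coord p a b y * coord p b a q := by
    rw [y1, y2]; nlinarith
  have k2 : coord p a b y * coord p b a r = coord p b a y * coord p a b r := by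
    rw [y1, y2]; ring
  have k3 : coord p a b y + coord p b a y < 1 := by rw [y1, y2]; nlinarith
  have hc := h.no_exit hS hT hr hcd hy' k1 k2.le k3
  have hd := h.no_exit hS hT hr (c := d) (d := c) (by rwa [Sym2.eq_swap])
    (by rwa [openSegment_symm]) k1 k2.le k3
  obtain ⟨u, u0, u1, f1, f2⟩ := mem_openSegment_iff_coords.1 hy'
  have v1 := coord_affine (p := p) (a := a) (b := b) f1 f2
  have v2 := coord_affine (p := p) (a := b) (b := a) f1 f2
  rw [v1, v2] at k2
  have key : (1 - u) * (coord p a b c * coord p b a r - coord p b a c * coord p a b r) +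
      u * (coord p a b d * coord p b a r - coord p b a d * coord p a b r) = 0 := by
    linear_combination k2
  have hc0 : coord p a b c * coord p b a r - coord p b a c * coord p a b r = 0 := by
    nlinarith
  have hd0 : coord p a b d * coord p b a r - coord p b a d * coord p a b r = 0 := by
    nlinarith
  have hcol : ∀ w ∈ S, coord p a b w * coord p b a r - coord p b a w * coord p a b r = 0 →
      w = p ∨ w = r := by
    intro w hw hw0
    refine hS.eq_or_eq h.memp hr.mem hw hpr ?_
    rw [cr_eq_coord h.cr_ne, coord_base, coord_base]
    linear_combination - cr p a b * hw0
  have hcdne := hT.ne hcd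
  rcases hcol c (hT.left_mem hcd) hc0 with rfl | rfl <;>
    rcases hcol d (hT.right_mem hcd) hd0 with rfl | rfl
  · exact hcdne rfl
  · exact hn hcd
  · exact hn (by rwa [Sym2.eq_swap])
  · exact hcdne rfl

lemma Closest.eq_of_add_eq_one (hS : GenPos S) (hD : cr p a b ≠ 0) (ha : a ∈ S) (hb : b ∈ S)
    (hab : a ≠ b) (hr : Closest S p q a b r) (h1 : coord p a b r + coord p b a r = 1) :
    r = a := by
  have hD' : cr p b a ≠ 0 := by rw [cr_swap]; exact neg_ne_zero.2 hD
  rcases hS.eq_or_eq ha hb hr.mem hab (by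
    rw [cr_eq_coord hD, coord_left hD, coord_left hD', coord_right, coord_right]
    linear_combination (-cr p a b) * h1) with rfl | rfl
  · rfl
  · have := hr.left_pos
    rw [coord_right] at this
    exact absurd this (lt_irrefl _)

lemma Nearest.no_cross_aux (hS : GenPos S) (hT : IsPlaneGraph S T)
    (h : Nearest S T p q a b) (hr : Closest S p q a b r) {c d y : Pt} (hcd : s(c, d) ∈ T)
    (hy : y ∈ openSegment ℝ c d)
    (hy1 : coord p b a y * coord p a b q < coord p a b y * coord p b a q)
    (hy2 : coord p a b y * coord p b a r < coord p b a y * coord p a b r)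
    (hy3 : coord p a b y + coord p b a y < 1) : False := by
  have hc := h.no_exit hS hT hr hcd hy hy1 hy2.le hy3
  have hd := h.no_exit hS hT hr (c := d) (d := c) (by rwa [Sym2.eq_swap])
    (by rwa [openSegment_symm]) hy1 hy2.le hy3
  obtain ⟨u, u0, u1, f1, f2⟩ := mem_openSegment_iff_coords.1 hy
  rw [coord_affine f1 f2, coord_affine f1 f2] at hy2
  nlinarith

lemma side_lt {q1 q2 r1 r2 s1 s2 : ℝ} (hq1 : 0 < q1) (hr1 : 0 < r1) (hs1 : 0 ≤ s1)
    (hr : r2 * q1 < r1 * q2) (hs : s1 * q2 < s2 * q1) : s1 * r2 < s2 * r1 := by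
  have h1 : s1 * (r2 * q1) ≤ s1 * (r1 * q2) := mul_le_mul_of_nonneg_left hr.le hs1
  have h2 : s1 * q2 * r1 < s2 * q1 * r1 := mul_lt_mul_of_pos_right hs hr1
  exact lt_of_mul_lt_mul_right (a := q1) (by linarith) hq1.le

lemma cr_param {p q c d z : Pt} {t : ℝ} (h1 : z.1 = p.1 + t * (q.1 - p.1))
    (h2 : z.2 = p.2 + t * (q.2 - p.2)) (hz : z ∈ openSegment ℝ c d) :
    t * (cr c d p - cr c d q) = cr c d p := by
  obtain ⟨u, -, -, e1, e2⟩ := mem_openSegment_iff_coords.1 hz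
  have : cr c d z = 0 := by unfold cr; rw [e1, e2]; ring
  have h3 : cr c d z = cr c d p + t * (cr c d q - cr c d p) := by
    unfold cr; rw [h1, h2]; ring
  linarith

lemma cr_sub_ne_zero (hS : GenPos S) {c d z : Pt} {t : ℝ} (hp : p ∈ S) (hq : q ∈ S) (hc : c ∈ S)
    (hd : d ∈ S) (hpq : p ≠ q) (hcd : c ≠ d) (hne : s(p, q) ≠ s(c, d))
    (h1 : z.1 = p.1 + t * (q.1 - p.1)) (h2 : z.2 = p.2 + t * (q.2 - p.2))
    (hz : z ∈ openSegment ℝ c d) : cr c d p - cr c d q ≠ 0 := by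
  intro h0
  have hp0 := cr_param h1 h2 hz
  rw [h0, mul_zero] at hp0
  have hq0 : cr c d q = 0 := by linarith
  rcases hS.eq_or_eq hc hd hp hcd hp0.symm with rfl | rfl <;>
    rcases hS.eq_or_eq hc hd hq hcd hq0 with rfl | rfl
  · exact hpq rfl
  · exact hne rfl
  · exact hne Sym2.eq_swap
  · exact hpq rfl

lemma eq_of_cross_of_shared (hS : GenPos S) {d z : Pt} (hp : p ∈ S) (hq : q ∈ S) (hd : d ∈ S)
    (hpq : p ≠ q) (hpd : p ≠ d) (h1 : z ∈ openSegment ℝ p q) (h2 : z ∈ openSegment ℝ p d) :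
    d = q := by
  obtain ⟨t, t0, -, e1, e2⟩ := mem_openSegment_iff_coords.1 h1
  obtain ⟨u, u0, -, f1, f2⟩ := mem_openSegment_iff_coords.1 h2
  have h3 : u * cr p q d = 0 := by
    unfold cr
    linear_combination (q.1 - p.1) * (e2 - f2) - (q.2 - p.2) * (e1 - f1)
  exact (hS.eq_or_eq hp hq hd hpq ((mul_eq_zero.1 h3).resolve_left u0.ne')).resolve_left hpd.symm

lemma exists_nearest (hS : GenPos S) (hT : IsPlaneGraph S T) (hsat : Saturated S T) (hp : p ∈ S)
    (hq : q ∈ S) (hpq : p ≠ q) (hn : s(p, q) ∉ T) :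
    ∃ a b, Nearest S T p q a b ∧ 0 < cr p a b := by
  suffices h : ∃ a b, Nearest S T p q a b by
    obtain ⟨a, b, h⟩ := h
    rcases lt_or_gt_of_ne h.cr_ne with h0 | h0
    · exact ⟨b, a, h.swap, by rw [cr_swap]; linarith⟩
    · exact ⟨a, b, h, h0⟩
  obtain ⟨c₀, d₀, h₀, hx₀⟩ := hsat p hp q hq hpq hn
  obtain ⟨⟨a, b⟩, hab, hmin⟩ := Finset.exists_min_image
    ((S ×ˢ S).filter fun e : Pt × Pt => s(e.1, e.2) ∈ T ∧
      (openSegment ℝ p q ∩ openSegment ℝ e.1 e.2).Nonempty)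
    (fun e => cr e.1 e.2 p / (cr e.1 e.2 p - cr e.1 e.2 q))
    ⟨(c₀, d₀), Finset.mem_filter.2 ⟨Finset.mem_product.2 ⟨hT.left_mem h₀, hT.right_mem h₀⟩,
      h₀, hx₀⟩⟩
  obtain ⟨-, habT, x, hx, hxab⟩ := Finset.mem_filter.1 hab
  simp only at habT hxab hmin
  have haS := hT.left_mem habT
  have hbS := hT.right_mem habT
  have hne := hT.ne habT
  have hparam : ∀ {c d z : Pt} {t : ℝ}, s(c, d) ∈ T → z.1 = p.1 + t * (q.1 - p.1) →
      z.2 = p.2 + t * (q.2 - p.2) → z ∈ openSegment ℝ c d →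
      cr c d p / (cr c d p - cr c d q) = t := by
    intro c d z t hcd h1 h2 hz
    have h3 := cr_param h1 h2 hz
    have h4 := cr_sub_ne_zero hS hp hq (hT.left_mem hcd) (hT.right_mem hcd) hpq (hT.ne hcd)
      (fun he => hn (he ▸ hcd)) h1 h2 hz
    rw [div_eq_iff h4, h3]
  have hpa : p ≠ a := by
    rintro rfl
    obtain rfl := eq_of_cross_of_shared hS hp hq hbS hpq hne hx hxab
    exact hn habT
  have hpb : p ≠ b := by
    rintro rfl
    rw [openSegment_symm] at hxab
    obtain rfl := eq_of_cross_of_shared hS hp hq haS hpq hne.symm hx hxab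
    exact hn (by rwa [Sym2.eq_swap])
  have hD : cr p a b ≠ 0 := hS.cr_ne_zero hp haS hbS hpa hpb hne
  have hD' : cr p b a ≠ 0 := by rw [cr_swap]; exact neg_ne_zero.2 hD
  obtain ⟨t, t0, t1, e1, e2⟩ := mem_openSegment_iff_coords.1 hx
  obtain ⟨u, u0, u1, f1, f2⟩ := mem_openSegment_iff_coords.1 hxab
  have k1 := coord_affine (p := p) (a := a) (b := b) e1 e2
  have k2 := coord_affine (p := p) (a := b) (b := a) e1 e2
  rw [coord_affine f1 f2, coord_base, coord_left hD, coord_right] at k1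
  rw [coord_affine f1 f2, coord_base, coord_left hD', coord_right] at k2
  have hq1 : 0 < coord p a b q := by
    refine pos_of_mul_pos_right (a := t) ?_ t0.le
    linarith
  have hq2 : 0 < coord p b a q := by
    refine pos_of_mul_pos_right (a := t) ?_ t0.le
    linarith
  have hsum : t * (coord p a b q + coord p b a q) = 1 := by linarith
  have hone : 1 < coord p a b q + coord p b a q := by nlinarith
  refine ⟨a, b, hp, hq, hpq, hn, habT, hD, hq1, hq2, hone, ?_⟩
  intro c d z τ hcd hcdne hz τ0 z1 z2 hτ
  have g1 : z.1 = p.1 + τ * (q.1 - p.1) := by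
    rw [fst_eq_coord hD z, fst_eq_coord hD q, z1, z2]; ring
  have g2 : z.2 = p.2 + τ * (q.2 - p.2) := by
    rw [snd_eq_coord hD z, snd_eq_coord hD q, z1, z2]; ring
  have hzpq : z ∈ openSegment ℝ p q :=
    mem_openSegment_iff_coords.2 ⟨τ, τ0, by nlinarith, g1, g2⟩
  have hle := hmin (c, d) (Finset.mem_filter.2
    ⟨Finset.mem_product.2 ⟨hT.left_mem hcd, hT.right_mem hcd⟩, hcd, z, hzpq, hz⟩)
  simp only at hle
  rw [hparam hcd g1 g2 hz, hparam habT e1 e2 hxab] at hle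
  have hτt : τ = t := le_antisymm (by nlinarith) hle
  have hzx : z = x := Prod.ext (by rw [g1, e1, hτt]) (by rw [g2, e2, hτt])
  exact hcdne (hT.eq_of_mem_openSegment hcd habT hz (hzx ▸ hxab))

/-- `pab` is a positively oriented triangle of `H` with no point of `S` in its interior. -/
def IsLink (S : Finset Pt) (H : Finset (Sym2 Pt)) (p a b : Pt) : Prop :=
  s(p, a) ∈ H ∧ s(p, b) ∈ H ∧ s(a, b) ∈ H ∧ 0 < cr p a b ∧
    ∀ w ∈ S, ¬ (0 < cr p a w ∧ 0 < cr a b w ∧ 0 < cr b p w)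

/-- In a saturated plane graph, a point `q` not adjacent to `p` is hidden from `p` by an edge of
the link of `p`. -/
theorem exists_link (hS : GenPos S) (hT : IsPlaneGraph S T) (hsat : Saturated S T) (hp : p ∈ S)
    (hq : q ∈ S) (hpq : p ≠ q) (hn : s(p, q) ∉ T) :
    ∃ r s, IsLink S T p r s ∧ (openSegment ℝ p q ∩ openSegment ℝ r s).Nonempty := by
  obtain ⟨a, b, h, hDpos⟩ := exists_nearest hS hT hsat hp hq hpq hn
  obtain ⟨r, hr⟩ := h.exists_closest hT
  obtain ⟨s, hs⟩ := h.swap.exists_closest hT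
  have hD := h.cr_ne
  have hprT := h.mem_closest hS hT hsat hr
  have hpsT := h.swap.mem_closest hS hT hsat hs
  have q1 := h.pos_left
  have q2 := h.pos_right
  have q3 := h.one_lt
  have r1 := hr.left_pos
  have r2 := hr.right_nonneg
  have r3 := hr.add_le
  have r4 := hr.side
  have s1 := hs.right_nonneg
  have s2 := hs.left_pos
  have s3 := hs.add_le
  have s4 := hs.side
  have hrs : coord p a b s * coord p b a r < coord p b a s * coord p a b r :=
    side_lt q1 r1 s1 r4 s4
  have hcr : 0 < cr p r s := by
    rw [cr_eq_coord hD, coord_base, coord_base]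
    exact mul_pos hDpos (by linarith)
  have hrsne : r ≠ s := by rintro rfl; linarith
  have hrsT : s(r, s) ∈ T := by
    by_contra hrsn
    obtain ⟨c, d, hcd, y, hy, hy'⟩ := hsat r hr.mem s hs.mem hrsne hrsn
    obtain ⟨μ, m0, m1, e1, e2⟩ := mem_openSegment_iff_coords.1 hy
    have y1 := coord_affine (p := p) (a := a) (b := b) e1 e2
    have y2 := coord_affine (p := p) (a := b) (b := a) e1 e2
    have hlt : coord p a b y + coord p b a y < 1 := by
      by_contra hge
      have hsum : coord p a b y + coord p b a y =
          (1 - μ) * (coord p a b r + coord p b a r) +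
            μ * (coord p b a s + coord p a b s) := by
        rw [y1, y2]; ring
      have hr1 : coord p a b r + coord p b a r = 1 := by nlinarith
      have hs1 : coord p b a s + coord p a b s = 1 := by nlinarith
      have haS := hT.left_mem h.memab
      have hbS := hT.right_mem h.memab
      have hne := hT.ne h.memab
      have era := hr.eq_of_add_eq_one hS hD haS hbS hne hr1
      have esb := hs.eq_of_add_eq_one hS h.swap.cr_ne hbS haS hne.symm hs1
      exact hrsn (by rw [era, esb]; exact h.memab)
    rcases lt_trichotomy (coord p b a y * coord p a b q) (coord p a b y * coord p b a q)
      with hg | hg | hg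
    · refine h.no_cross_aux hS hT hr hcd hy' hg ?_ hlt
      rw [y1, y2]; nlinarith
    · have hτ : coord p b a y = coord p a b y / coord p a b q * coord p b a q := by
        field_simp; linarith
      have ypos : 0 < coord p a b y := by
        rw [y1]
        have : 0 < (1 - μ) * coord p a b r := mul_pos (by linarith) r1
        have : 0 ≤ μ * coord p a b s := mul_nonneg m0.le s1
        linarith
      refine h.near c d y (coord p a b y / coord p a b q) hcd ?_ hy' (div_pos ypos q1)
        (by field_simp) hτ ?_
      · intro he
        have hy'' : y ∈ openSegment ℝ a b := by
          rcases Sym2.eq_iff.1 he with ⟨rfl, rfl⟩ | ⟨rfl, rfl⟩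
          · exact hy'
          · rwa [openSegment_symm]
        obtain ⟨t, -, -, f1, f2⟩ := mem_openSegment_iff_coords.1 hy''
        rw [coord_affine f1 f2, coord_affine f1 f2, coord_left hD, coord_left h.swap.cr_ne,
          coord_right, coord_right] at hlt
        linarith
      · rw [mul_add, ← hτ, div_mul_cancel₀ _ q1.ne']
        exact hlt.le
    · refine h.swap.no_cross_aux hS hT hs hcd hy' hg ?_ (by linarith)
      rw [y1, y2]; nlinarith
  refine ⟨r, s, ⟨hprT, hpsT, hrsT, hcr, ?_⟩, ?_⟩
  · rintro w hw ⟨w1, w2, w3⟩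
    have hbary : cr p r w + cr r s w + cr s p w = cr p r s := by unfold cr; ring
    have c1 : cr p r s * coord p a b w =
        cr s p w * coord p a b r + cr p r w * coord p a b s := by
      simp only [cr_eq_coord hD s p w, cr_eq_coord hD p r w, cr_eq_coord hD p r s, coord_base]
      ring
    have c2 : cr p r s * coord p b a w =
        cr s p w * coord p b a r + cr p r w * coord p b a s := by
      simp only [cr_eq_coord hD s p w, cr_eq_coord hD p r w, cr_eq_coord hD p r s, coord_base]
      ring
    have p1 : 0 < coord p a b w := by
      refine pos_of_mul_pos_right (a := cr p r s) ?_ hcr.le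
      rw [c1]
      exact add_pos_of_pos_of_nonneg (mul_pos w3 r1) (mul_nonneg w1.le s1)
    have p2 : 0 < coord p b a w := by
      refine pos_of_mul_pos_right (a := cr p r s) ?_ hcr.le
      rw [c2]
      exact add_pos_of_nonneg_of_pos (mul_nonneg w3.le r2) (mul_pos w1 s2)
    have p3 : coord p a b w + coord p b a w ≤ 1 := by
      refine le_of_mul_le_mul_left (a := cr p r s) ?_ hcr
      nlinarith
    rw [cr_eq_coord hD, coord_base, coord_base] at w1 w3
    have w1' := pos_of_mul_pos_right w1 hDpos.le
    have w3' := pos_of_mul_pos_right w3 hDpos.le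
    rcases lt_trichotomy (coord p b a w * coord p a b q) (coord p a b w * coord p b a q)
      with hg | hg | hg
    · have := hr.min w hw p1 p2 p3 hg
      linarith
    · rcases h.eq_of_coord_mul_eq hS hw hg with rfl | rfl
      · rw [coord_base] at p1; exact lt_irrefl _ p1
      · linarith
    · have := hs.min w hw p2 p1 (by linarith) hg
      linarith
  · have g1 : 0 < coord p a b r * coord p b a q - coord p b a r * coord p a b q := by linarith
    have g2 : 0 < coord p b a s * coord p a b q - coord p a b s * coord p b a q := by linarith
    obtain ⟨μ, hμ⟩ : ∃ μ, μ = (coord p a b r * coord p b a q - coord p b a r * coord p a b q) /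
      ((coord p a b r * coord p b a q - coord p b a r * coord p a b q) +
        (coord p b a s * coord p a b q - coord p a b s * coord p b a q)) := ⟨_, rfl⟩
    have m0 : 0 < μ := by rw [hμ]; exact div_pos g1 (by linarith)
    have m1 : μ < 1 := by rw [hμ, div_lt_one (by linarith)]; linarith
    have m2 := (eq_div_iff (by linarith)).1 hμ
    obtain ⟨z, e1, e2⟩ := exists_point r s μ
    have z1 := coord_affine (p := p) (a := a) (b := b) e1 e2
    have z2 := coord_affine (p := p) (a := b) (b := a) e1 e2
    have zpos : 0 < coord p a b z := by
      rw [z1]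
      have : 0 < (1 - μ) * coord p a b r := mul_pos (by linarith) r1
      have : 0 ≤ μ * coord p a b s := mul_nonneg m0.le s1
      linarith
    have zle : coord p a b z + coord p b a z ≤ 1 := by rw [z1, z2]; nlinarith
    have zg : coord p b a z * coord p a b q = coord p a b z * coord p b a q := by
      rw [z1, z2]; linarith
    have hτ : coord p b a z = coord p a b z / coord p a b q * coord p b a q := by
      field_simp; linarith
    refine ⟨z, mem_openSegment_of_coord hD (μ := coord p a b z / coord p a b q)
      (div_pos zpos q1) ?_ ?_ ?_, mem_openSegment_iff_coords.2 ⟨μ, m0, m1, e1, e2⟩⟩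
    · rw [div_lt_one q1]
      by_contra hcon
      push Not at hcon
      have : coord p b a q * coord p a b q ≤ coord p b a z * coord p a b q := by
        rw [zg, mul_comm]; exact mul_le_mul_of_nonneg_right hcon q2.le
      have := le_of_mul_le_mul_right this q1
      linarith
    · rw [coord_base]; field_simp; ring
    · rw [coord_base, hτ]; ring

end Link

/-- The edges of `H` at `p`. -/
def edgesAt (H : Finset (Sym2 Pt)) (p : Pt) : Finset (Sym2 Pt) := H.filter fun e => p ∈ e

/-- The edges of `H` opposite to `p` in an empty triangle. -/
def link (S : Finset Pt) (H : Finset (Sym2 Pt)) (p : Pt) : Finset (Sym2 Pt) :=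
  H.filter fun e => ∃ a b, e = s(a, b) ∧ IsLink S H p a b

/-- The edges at `p` together with the edges of the link of `p`. -/
def wheel (S : Finset Pt) (H : Finset (Sym2 Pt)) (p : Pt) : Finset (Sym2 Pt) :=
  edgesAt H p ∪ link S H p

section Wheel

variable {S : Finset Pt} {T H G : Finset (Sym2 Pt)} {p a b c : Pt}

lemma mem_edgesAt : s(p, a) ∈ edgesAt H p ↔ s(p, a) ∈ H := by simp [edgesAt]

lemma IsLink.mono (h : IsLink S H p a b) (hHT : H ⊆ T) : IsLink S T p a b :=
  ⟨hHT h.1, hHT h.2.1, hHT h.2.2.1, h.2.2.2⟩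

lemma wheel_mono (hHT : H ⊆ T) : wheel S H p ⊆ wheel S T p := by
  refine Finset.union_subset_union (Finset.filter_subset_filter _ hHT) ?_
  intro e he
  obtain ⟨heH, a, b, hab, hl⟩ := Finset.mem_filter.1 he
  exact Finset.mem_filter.2 ⟨hHT heH, a, b, hab, hl.mono hHT⟩

lemma wheel_subset : wheel S H p ⊆ H :=
  Finset.union_subset (Finset.filter_subset _ _) (Finset.filter_subset _ _)

lemma IsLink.mem_wheel (h : IsLink S H p a b) :
    s(p, a) ∈ wheel S H p ∧ s(p, b) ∈ wheel S H p ∧ s(a, b) ∈ wheel S H p :=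
  ⟨Finset.mem_union_left _ (mem_edgesAt.2 h.1), Finset.mem_union_left _ (mem_edgesAt.2 h.2.1),
    Finset.mem_union_right _ (Finset.mem_filter.2 ⟨h.2.2.1, a, b, rfl, h⟩)⟩

lemma wheel_eq_of_subset (h1 : wheel S T p ⊆ H) (h2 : H ⊆ T) : wheel S H p = wheel S T p := by
  refine (wheel_mono h2).antisymm fun e he => ?_
  have heH := h1 he
  rcases Finset.mem_union.1 he with he | he
  · exact Finset.mem_union_left _ (Finset.mem_filter.2 ⟨heH, (Finset.mem_filter.1 he).2⟩)
  · obtain ⟨-, a, b, hab, hl⟩ := Finset.mem_filter.1 he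
    obtain ⟨m1, m2, m3⟩ := hl.mem_wheel
    exact Finset.mem_union_right _ (Finset.mem_filter.2
      ⟨heH, a, b, hab, h1 m1, h1 m2, h1 m3, hl.2.2.2⟩)

lemma IsLink.not_between (hS : GenPos S) (hT : IsPlaneGraph S T) (h : IsLink S T p a b)
    (hc : s(p, c) ∈ T) (h1 : 0 < cr p a c) (h2 : 0 < cr p c b) : False := by
  obtain ⟨hpa, hpb, hab, hD, hempty⟩ := h
  have hcS := hT.right_mem hc
  have ha := hT.left_mem hab
  have hb := hT.right_mem hab
  have hac : a ≠ c := by rintro rfl; unfold cr at h1; linarith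
  have hbc : b ≠ c := by rintro rfl; unfold cr at h2; linarith
  have hD' : cr p b a < 0 := by rw [cr_swap]; linarith
  rcases lt_or_gt_of_ne (hS.cr_ne_zero ha hb hcS (hT.ne hab) hac hbc) with h3 | h3
  · have c1 : 0 < coord p a b c := div_pos h2 hD
    have c2 : 0 < coord p b a c :=
      div_pos_of_neg_of_neg (by rw [cr_swap]; linarith) hD'
    have hsum : 1 < coord p a b c + coord p b a c := by
      rw [cr_eq_coord hD.ne', coord_left hD.ne', coord_left hD'.ne, coord_right,
        coord_right] at h3
      nlinarith
    obtain ⟨z, e1, e2⟩ := exists_point p c (1 / (coord p a b c + coord p b a c))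
    have hz1 := coord_affine (p := p) (a := a) (b := b) e1 e2
    have hz2 := coord_affine (p := p) (a := b) (b := a) e1 e2
    rw [coord_base, sub_zero, zero_add] at hz1 hz2
    have hz : z ∈ openSegment ℝ a b := by
      refine mem_openSegment_of_coord_add_eq_one hD.ne' ?_ ?_ ?_
      · rw [hz1]; positivity
      · rw [hz2]; positivity
      · rw [hz1, hz2]; field_simp
    have hz' : z ∈ openSegment ℝ p c :=
      mem_openSegment_iff_coords.2 ⟨_, by positivity, by
        rw [div_lt_one (by linarith)]; exact hsum, e1, e2⟩
    have heq := hT.eq_of_mem_openSegment hab hc hz hz'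
    rcases Sym2.eq_iff.1 heq with ⟨rfl, -⟩ | ⟨-, rfl⟩
    · exact hT.ne hpa rfl
    · exact hT.ne hpb rfl
  · refine hempty c hcS ⟨h1, h3, ?_⟩
    have : cr b p c = cr p c b := by unfold cr; ring
    rwa [this]

lemma card_link_le (hS : GenPos S) (hT : IsPlaneGraph S T) :
    (link S T p).card ≤ (edgesAt T p).card := by
  refine Finset.card_le_card_of_forall_subsingleton
    (fun e f => ∃ a b, e = s(a, b) ∧ f = s(p, a) ∧ IsLink S T p a b) ?_ ?_
  · intro e he
    obtain ⟨-, a, b, hab, hl⟩ := Finset.mem_filter.1 he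
    exact ⟨s(p, a), mem_edgesAt.2 hl.1, a, b, hab, rfl, hl⟩
  · rintro f - _ ⟨-, a, b, rfl, rfl, hl⟩ _ ⟨-, a', b', rfl, hf, hl'⟩
    obtain rfl := Sym2.congr_right.1 hf
    by_contra hne
    have hbb : b ≠ b' := by rintro rfl; exact hne rfl
    have hp := hT.left_mem hl.1
    have hb := hT.right_mem hl.2.1
    have hb' := hT.right_mem hl'.2.1
    rcases lt_or_gt_of_ne (hS.cr_ne_zero hp hb hb' (hT.ne hl.2.1) (hT.ne hl'.2.1) hbb)
      with h | h
    · exact hl.not_between hS hT hl'.2.1 hl'.2.2.2.1 (by rw [cr_swap]; linarith)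
    · exact hl'.not_between hS hT hl.2.1 hl.2.2.2.1 h

lemma card_wheel_le (hS : GenPos S) (hT : IsPlaneGraph S T) :
    (wheel S T p).card ≤ 2 * (edgesAt T p).card := by
  have h1 : (wheel S T p).card ≤ _ := Finset.card_union_le _ _
  have h2 := card_link_le (p := p) hS hT
  omega

lemma sum_card_edgesAt_le (S : Finset Pt) (T : Finset (Sym2 Pt)) :
    ∑ p ∈ S, (edgesAt T p).card ≤ 2 * T.card := by
  have h := Finset.sum_card_bipartiteAbove_eq_sum_card_bipartiteBelow
    (s := S) (t := T) (fun p e => p ∈ e)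
  simp only [Finset.bipartiteAbove, Finset.bipartiteBelow] at h
  simp only [edgesAt]
  rw [h, mul_comm]
  refine Finset.sum_le_card_nsmul _ _ _ fun e _ => ?_
  induction e using Sym2.ind with
  | _ a b =>
    refine (Finset.card_le_card (t := {a, b}) ?_).trans Finset.card_le_two
    intro x hx
    simpa using (Finset.mem_filter.1 hx).2

lemma sum_card_wheel_le (hS : GenPos S) (hT : IsPlaneGraph S T) :
    ∑ p ∈ S, (wheel S T p).card ≤ 12 * S.card := by
  have h1 : ∑ p ∈ S, (wheel S T p).card ≤ ∑ p ∈ S, 2 * (edgesAt T p).card :=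
    Finset.sum_le_sum fun p _ => card_wheel_le hS hT
  rw [← Finset.mul_sum] at h1
  have h2 := sum_card_edgesAt_le S T
  have h3 := card_le_three_mul hS hT
  omega

lemma exists_saturated (hG : IsPlaneGraph S G) :
    ∃ T, G ⊆ T ∧ IsPlaneGraph S T ∧ Saturated S T := by
  obtain ⟨T, hGT, hT⟩ := (planeGraphs S).exists_le_maximal (mem_planeGraphs.2 hG)
  have hTp := mem_planeGraphs.1 hT.prop
  refine ⟨T, hGT, hTp, fun p hp q hq hpq hn => ?_⟩
  refine exists_cross_of_not_insert hTp hp hq hpq fun hins => hn ?_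
  exact hT.le_of_ge (mem_planeGraphs.2 hins) (Finset.subset_insert _ _)
    (Finset.mem_insert_self _ _)

lemma isXVing_of_wheel_subset (hS : GenPos S) (hT : IsPlaneGraph S T) (hsat : Saturated S T)
    (hp : p ∈ S) (h1 : wheel S T p ⊆ H) : IsXVing S H p := by
  intro q hq hqp hn hins
  have hnT : s(p, q) ∉ T := fun h => hn (h1 (Finset.mem_union_left _ (mem_edgesAt.2 h)))
  obtain ⟨r, s, hl, z, hz1, hz2⟩ := exists_link hS hT hsat hp hq hqp.symm hnT
  have hrs := h1 hl.mem_wheel.2.2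
  have := hins.eq_of_mem_openSegment (Finset.mem_insert_self _ _)
    (Finset.mem_insert_of_mem hrs) hz1 hz2
  exact hn (this ▸ hrs)

end Wheel

lemma half_pow_ge (k : ℕ) : (1 + (12 - (k : ℝ)) / 2) / 4096 ≤ (1 / 2 : ℝ) ^ k := by
  rcases le_or_gt k 12 with h | h
  · interval_cases k <;> norm_num
  · rcases (show 13 ≤ k from h).eq_or_lt with rfl | h
    · norm_num
    · have : (14 : ℝ) ≤ k := by exact_mod_cast h
      exact le_trans (by linarith) (pow_nonneg (by norm_num) k)

/-- The plane graphs `G` that turn into the same graph `H` when the wheel of `p` is added have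
total weight at most one. -/
lemma sum_fiber_le {S : Finset Pt} {p : Pt} {T : Finset (Sym2 Pt) → Finset (Sym2 Pt)}
    (hT : ∀ G ∈ planeGraphs S, G ⊆ T G) (H : Finset (Sym2 Pt)) :
    ∑ G ∈ (planeGraphs S).filter (fun G => G ∪ wheel S (T G) p = H),
      (1 / 2 : ℝ) ^ (wheel S (T G) p).card ≤ 1 := by
  have hw : ∀ G ∈ (planeGraphs S).filter (fun G => G ∪ wheel S (T G) p = H),
      wheel S (T G) p = wheel S H p := by
    intro G hG
    obtain ⟨hG₁, rfl⟩ := Finset.mem_filter.1 hG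
    exact (wheel_eq_of_subset Finset.subset_union_right
      (Finset.union_subset (hT G hG₁) wheel_subset)).symm
  rw [Finset.sum_congr rfl fun G hG => by rw [hw G hG], Finset.sum_const, nsmul_eq_mul]
  have hcard : ((planeGraphs S).filter (fun G => G ∪ wheel S (T G) p = H)).card ≤
      2 ^ (wheel S H p).card := by
    rw [← Finset.card_powerset]
    refine Finset.card_le_card_of_injOn (fun G => G ∩ wheel S H p)
      (fun G _ => Finset.mem_powerset.2 Finset.inter_subset_right) ?_
    intro G hG G' hG' h
    have e1 := (Finset.mem_filter.1 hG).2
    have e2 := (Finset.mem_filter.1 hG').2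
    rw [hw G hG] at e1
    rw [hw G' hG'] at e2
    ext e
    have i1 := Finset.ext_iff.1 e1 e
    have i2 := Finset.ext_iff.1 e2 e
    have i3 := Finset.ext_iff.1 h e
    simp only [Finset.mem_union, Finset.mem_inter] at i1 i2 i3
    tauto
  calc _ ≤ (2 : ℝ) ^ (wheel S H p).card * (1 / 2 : ℝ) ^ (wheel S H p).card :=
        mul_le_mul_of_nonneg_right (by exact_mod_cast hcard) (by positivity)
    _ = 1 := by rw [← mul_pow]; norm_num

lemma sum_weight_le {S : Finset Pt} (hS : GenPos S) {p : Pt} (hp : p ∈ S)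
    {T : Finset (Sym2 Pt) → Finset (Sym2 Pt)}
    (hT : ∀ G ∈ planeGraphs S, G ⊆ T G ∧ IsPlaneGraph S (T G) ∧ Saturated S (T G)) :
    ∑ G ∈ planeGraphs S, (1 / 2 : ℝ) ^ (wheel S (T G) p).card ≤
      ((planeGraphs S).filter fun G => IsXVing S G p).card := by
  have hmaps : ∀ G ∈ planeGraphs S,
      G ∪ wheel S (T G) p ∈ (planeGraphs S).filter fun G => IsXVing S G p := by
    intro G hG
    obtain ⟨h1, h2, h3⟩ := hT G hG
    exact Finset.mem_filter.2 ⟨mem_planeGraphs.2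
      (h2.mono (Finset.union_subset h1 wheel_subset)),
      isXVing_of_wheel_subset hS h2 h3 hp Finset.subset_union_right⟩
  rw [← Finset.sum_fiberwise_of_maps_to hmaps, Finset.card_eq_sum_ones, Nat.cast_sum]
  refine Finset.sum_le_sum fun H _ => ?_
  rw [Nat.cast_one]
  exact sum_fiber_le (fun G hG => (hT G hG).1) H

/-- Lemma 2.2. For every set `S` of `N` points in general
position, `ĥv_x(S) ≥ N / 4096`. -/
theorem stmt1 (S : Finset Pt) (hgp : GenPos S) :
    (S.card : ℝ) / 4096 ≤ hvx S := by
  have hex : ∀ G : Finset (Sym2 Pt), ∃ T, G ∈ planeGraphs S →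
      G ⊆ T ∧ IsPlaneGraph S T ∧ Saturated S T := by
    intro G
    by_cases hG : G ∈ planeGraphs S
    · obtain ⟨T, hT⟩ := exists_saturated (mem_planeGraphs.1 hG)
      exact ⟨T, fun _ => hT⟩
    · exact ⟨∅, fun h => absurd h hG⟩
  choose T hT using hex
  have hpos : 0 < (planeGraphs S).card :=
    Finset.card_pos.2 ⟨∅, mem_planeGraphs.2 ⟨by simp, by simp⟩⟩
  rw [hvx, le_div_iff₀ (by exact_mod_cast hpos)]
  have hcount : ∑ G ∈ planeGraphs S, (vx S G : ℝ) =
      ∑ p ∈ S, (((planeGraphs S).filter fun G => IsXVing S G p).card : ℝ) := by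
    have h := Finset.sum_card_bipartiteAbove_eq_sum_card_bipartiteBelow
      (s := planeGraphs S) (t := S) (fun G p => IsXVing S G p)
    simp only [Finset.bipartiteAbove, Finset.bipartiteBelow] at h
    exact_mod_cast h
  have hG : ∀ G ∈ planeGraphs S, (S.card : ℝ) / 4096 ≤
      ∑ p ∈ S, (1 / 2 : ℝ) ^ (wheel S (T G) p).card := by
    intro G hG
    have h1 : (∑ p ∈ S, ((wheel S (T G) p).card : ℝ)) ≤ 12 * S.card := by
      exact_mod_cast sum_card_wheel_le hgp (hT G hG).2.1
    have h2 : ∑ p ∈ S, (1 + (12 - ((wheel S (T G) p).card : ℝ)) / 2) / 4096 ≤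
        ∑ p ∈ S, (1 / 2 : ℝ) ^ (wheel S (T G) p).card :=
      Finset.sum_le_sum fun p _ => half_pow_ge _
    rw [← Finset.sum_div, Finset.sum_add_distrib, ← Finset.sum_div, Finset.sum_sub_distrib,
      Finset.sum_const, Finset.sum_const, nsmul_eq_mul, nsmul_eq_mul] at h2
    linarith
  calc (S.card : ℝ) / 4096 * (planeGraphs S).card
      = ∑ _G ∈ planeGraphs S, (S.card : ℝ) / 4096 := by
        rw [Finset.sum_const, nsmul_eq_mul, mul_comm]
    _ ≤ ∑ G ∈ planeGraphs S, ∑ p ∈ S, (1 / 2 : ℝ) ^ (wheel S (T G) p).card :=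
        Finset.sum_le_sum hG
    _ = ∑ p ∈ S, ∑ G ∈ planeGraphs S, (1 / 2 : ℝ) ^ (wheel S (T G) p).card :=
        Finset.sum_comm
    _ ≤ _ := by
        rw [hcount]
        exact Finset.sum_le_sum fun p hp => sum_weight_le hgp hp hT
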